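/- Let A be a σ-finite AW*-algebra, let I be a closed right ideal of A with ℓ_A(I) = {0}, and let f : I → A be a bounded right A-module map. Then there exists a unique element c ∈ A such that f(x) = cx for all x ∈ I. -/

import Mathlib

variable {A : Type*} [CStarAlgebra A]

/-- A submodule `J ⊆ A` is a right ideal if it is closed under right multiplication
by arbitrary elements of `A`. -/
def IsRightIdeal (J : Submodule ℂ A) : Prop :=
  ∀ x ∈ J, ∀ a : A, x * a ∈ J

/-- A unital C*-algebra is an AW*-algebra if the right annihilator of every subset is
generated, as a right ideal, by a projection. -/
def IsAWStar (A : Type*) [CStarAlgebra A] : Prop :=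
  ∀ S : Set A, ∃ p : A, star p = p ∧ p * p = p ∧
    ∀ a : A, (∀ s ∈ S, s * a = 0) ↔ ∃ b : A, a = p * b

/-- An algebra is σ-finite if every family of pairwise orthogonal nonzero projections
is countable. -/
def SigmaFiniteAlg (A : Type*) [CStarAlgebra A] : Prop :=
  ∀ P : Set A, (∀ p ∈ P, star p = p ∧ p * p = p ∧ p ≠ 0) →
    (∀ p ∈ P, ∀ q ∈ P, p ≠ q → p * q = 0) → P.Countable

open Filter Topology

attribute [local instance] CStarAlgebra.spectralOrder CStarAlgebra.spectralOrderedRing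

/-- In an AW*-algebra right annihilators are ranges of projections. -/
theorem IsAWStar.exists_annihilator (hAW : IsAWStar A) (S : Set A) :
    ∃ p : A, IsStarProjection p ∧ ∀ a : A, (∀ s ∈ S, s * a = 0) ↔ p * a = a := by
  obtain ⟨p, hs, hi, h⟩ := hAW S
  refine ⟨p, ⟨hi, hs⟩, fun a => (h a).trans ⟨?_, fun ha => ⟨a, ha.symm⟩⟩⟩
  rintro ⟨b, rfl⟩
  rw [← mul_assoc, hi]

theorem IsAWStar.exists_support (hAW : IsAWStar A) (S : Set A) :
    ∃ p : A, IsStarProjection p ∧ (∀ s ∈ S, s * p = s) ∧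
      ∀ a : A, (∀ s ∈ S, s * a = 0) → p * a = 0 := by
  obtain ⟨p, hp, h⟩ := hAW.exists_annihilator S
  refine ⟨1 - p, hp.one_sub, fun s hs => ?_, fun a ha => ?_⟩
  · have := (h p).2 hp.isIdempotentElem s hs
    rw [mul_sub, this, mul_one, sub_zero]
  · rw [sub_mul, (h a).1 ha, one_mul, sub_self]

theorem mul_eq_zero_of_star_mul_mul {x b : A} (h : star x * x * b = 0) : x * b = 0 := by
  rw [← CStarRing.star_mul_self_eq_zero_iff, star_mul, mul_assoc, ← mul_assoc (star x), h, mul_zero]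

/-- The support projection of the positive part of a self-adjoint element. -/
theorem IsAWStar.exists_posPart_support (hAW : IsAWStar A) {x : A} (hx : IsSelfAdjoint x) :
    ∃ p : A, IsStarProjection p ∧ Commute p x ∧
      p * cfc (fun t : ℝ => max t 0) x = cfc (fun t : ℝ => max t 0) x ∧
      p * cfc (fun t : ℝ => max (-t) 0) x = 0 ∧ ∀ b, x * b = 0 → p * b = 0 := by
  set u := cfc (fun t : ℝ => max t 0) x with hu
  set w := cfc (fun t : ℝ => max (-t) 0) x with hw
  have hus : star u = u := (cfc_predicate _ x : IsSelfAdjoint u)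
  have huw : u * w = 0 := by
    rw [hu, hw, ← cfc_mul .., ← cfc_zero ℝ x]
    refine cfc_congr fun t _ => ?_
    rcases le_total t 0 with h | h <;> simp [h]
  have hsub : u - w = x := by
    rw [hu, hw, ← cfc_sub ..]
    conv_rhs => rw [← cfc_id ℝ x]
    refine cfc_congr fun t _ => ?_
    rcases le_total t 0 with h | h <;> simp [h]
  have huu : u * u = u * x := by rw [← hsub, mul_sub, huw, sub_zero]
  obtain ⟨p, hp, h1, h2⟩ := hAW.exists_support {u}
  have hup : u * p = u := h1 u rfl
  have hpu : p * u = u := by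
    simpa [star_mul, hus, hp.isSelfAdjoint.star_eq] using congrArg star hup
  have hpw : p * w = 0 := h2 w (by simpa using huw)
  have hpx : p * x = u := by rw [← hsub, mul_sub, hpu, hpw, sub_zero]
  refine ⟨p, hp, ?_, hpu, hpw, fun b hb => h2 b ?_⟩
  · rw [commute_iff_eq, hpx]
    simpa [star_mul, hus, hp.isSelfAdjoint.star_eq, hx.star_eq] using (congrArg star hpx).symm
  · rintro s rfl
    exact mul_eq_zero_of_star_mul_mul (by rw [hus, huu, mul_assoc, hb, mul_zero])

/-- A nonzero positive element is bounded below on a nonzero projection commuting with it. -/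
theorem IsAWStar.exists_spectral_projection (hAW : IsAWStar A) {k : A} (hk : 0 ≤ k)
    (hk0 : k ≠ 0) :
    ∃ p y : A, IsStarProjection p ∧ p ≠ 0 ∧ star y = y ∧ y * p = y ∧ y * k * y = p ∧
      k * (y * y) = p ∧ p * k = k * p := by
  have hks : IsSelfAdjoint k := .of_nonneg hk
  obtain ⟨ε, hε, hεk⟩ : ∃ ε : ℝ, 0 < ε ∧ ε < ‖k‖ :=
    ⟨‖k‖ / 2, by have := norm_pos_iff.2 hk0; linarith, by have := norm_pos_iff.2 hk0; linarith⟩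
  set x := k - algebraMap ℝ A ε with hx
  have hxs : IsSelfAdjoint x := hks.sub (IsSelfAdjoint.algebraMap A (.all ε))
  have hxc : x = cfc (fun t : ℝ => t - ε) k := by
    rw [cfc_sub .., cfc_const .., cfc_id' ..]
  obtain ⟨p, hp, hpx, hpu, hpw, -⟩ := hAW.exists_posPart_support hxs
  have hpk : Commute p k := by
    have : k = x + algebraMap ℝ A ε := by rw [hx]; abel
    rw [this]
    exact hpx.add_right (Algebra.commutes ε p).symm
  have hu : cfc (fun t : ℝ => max t 0) x = cfc (fun t : ℝ => max (t - ε) 0) k := by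
    rw [hxc, ← cfc_comp' ..]
  have hw : cfc (fun t : ℝ => max (-t) 0) x = cfc (fun t : ℝ => max (ε - t) 0) k := by
    rw [hxc, ← cfc_comp' ..]
    simp
  rw [hu] at hpu
  rw [hw] at hpw
  have hmpos : ∀ t : ℝ, 0 < max t ε := fun t => lt_of_lt_of_le hε (le_max_right _ _)
  obtain ⟨G, hGc, hG⟩ : ∃ G : ℝ → ℝ, Continuous G ∧ ∀ t, G t * G t * max t ε = 1 := by
    refine ⟨fun t : ℝ => (√(max t ε))⁻¹,
      Continuous.inv₀ (by fun_prop) fun t => (Real.sqrt_pos.2 (hmpos t)).ne', fun t => ?_⟩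
    have := hmpos t
    rw [← mul_inv, Real.mul_self_sqrt this.le, inv_mul_cancel₀ this.ne']
  set g := cfc G k with hg
  have hgs : star g = g := (cfc_predicate _ k : IsSelfAdjoint g)
  have hpg : Commute p g := (hpk.symm.cfc_real _).symm
  have hggm : g * g * cfc (fun t : ℝ => max t ε) k = 1 := by
    rw [hg, ← cfc_mul G G k, ← cfc_mul (fun t => G t * G t) _ k, ← cfc_one ℝ k]
    exact cfc_congr fun t _ => hG t
  have hmw : cfc (fun t : ℝ => max t ε) k - cfc (fun t : ℝ => max (ε - t) 0) k = k := by
    rw [← cfc_sub ..]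
    conv_rhs => rw [← cfc_id ℝ k]
    refine cfc_congr fun t _ => ?_
    rcases le_total t ε with h | h <;> simp [h]
  have hwp : cfc (fun t : ℝ => max (ε - t) 0) k * p = 0 := by
    rw [((hpk.symm.cfc_real (fun t : ℝ => max (ε - t) 0))).eq, hpw]
  have hggk : g * g * k * p = p := by
    have : g * g * k * p = g * g * (cfc (fun t : ℝ => max t ε) k * p) -
        g * g * (cfc (fun t : ℝ => max (ε - t) 0) k * p) := by
      rw [← mul_sub, ← sub_mul, hmw, mul_assoc]
    rw [this, hwp, ← mul_assoc, hggm, one_mul, mul_zero, sub_zero]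
  have hgk : Commute k g := (Commute.refl k).cfc_real _ |>.symm
  have hpp := hp.isIdempotentElem.eq
  have hy : k * (g * p * (g * p)) = p := by
    have e1 : g * p * (g * p) = g * g * p := by
      rw [mul_assoc, ← mul_assoc p, hpg.eq, mul_assoc g p p, hpp, mul_assoc]
    rw [e1, ← mul_assoc, (hgk.mul_right hgk).eq, hggk]
  refine ⟨p, g * p, hp, ?_, ?_, ?_, ?_, hy, hpk.eq⟩
  · rintro rfl
    rw [zero_mul] at hpu
    have : Nontrivial A := ⟨k, 0, hk0⟩
    have := norm_apply_le_norm_cfc (fun t : ℝ => max (t - ε) 0) k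
      (CStarAlgebra.norm_mem_spectrum_of_nonneg hk)
    rw [← hpu, norm_zero, Real.norm_of_nonneg (le_max_right _ _)] at this
    have := (le_max_left _ _).trans this
    linarith
  · rw [star_mul, hgs, hp.isSelfAdjoint.star_eq, hpg.eq]
  · rw [mul_assoc, hpp]
  · have : Commute k (g * p) := hgk.mul_right hpk.symm
    rw [← this.eq, mul_assoc, hy]

/-- A self-adjoint contraction is within `1/2` of half a symmetry of its corner. -/
theorem IsAWStar.exists_half_symmetry (hAW : IsAWStar A) {s g : A} (hs : IsSelfAdjoint s)
    (hs1 : ‖s‖ ≤ 1) (hg : IsStarProjection g) (hsg : s * g = s) :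
    ∃ p : A, IsStarProjection p ∧ p * g = p ∧ ‖(2 : ℂ) • s - ((2 : ℂ) • p - g)‖ ≤ 1 := by
  obtain ⟨p, hp, hpx, hpu, hpw, hpker⟩ := hAW.exists_posPart_support hs
  have hpg : p * g = p := by
    have := hpker (1 - g) (by rw [mul_sub, hsg, mul_one, sub_self])
    rw [mul_sub, mul_one, sub_eq_zero] at this
    exact this.symm
  refine ⟨p, hp, hpg, ?_⟩
  have hgs : g * s = s := by
    simpa [star_mul, hs.star_eq, hg.isSelfAdjoint.star_eq] using congrArg star hsg
  have hgp : g * p = p := by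
    simpa [star_mul, hp.isSelfAdjoint.star_eq, hg.isSelfAdjoint.star_eq] using congrArg star hpg
  rcases subsingleton_or_nontrivial A with hA | hA
  · rw [Subsingleton.elim (_ - _ : A) 0, norm_zero]
    exact zero_le_one
  set u := cfc (fun t : ℝ => max t 0) s with hu
  set w := cfc (fun t : ℝ => max (-t) 0) s with hw
  have hsub : s = u - w := by
    rw [hu, hw, ← cfc_sub ..]
    conv_lhs => rw [← cfc_id ℝ s]
    refine cfc_congr fun t _ => ?_
    rcases le_total t 0 with h | h <;> simp [h]
  have hnorm : ‖(u + w) + (u + w) - 1‖ ≤ 1 := by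
    rw [hu, hw, ← cfc_add .., ← cfc_add .., ← cfc_one ℝ s, ← cfc_sub ..]
    refine norm_cfc_le zero_le_one fun t ht => ?_
    have ht1 : |t| ≤ 1 := (spectrum.norm_le_norm_of_mem ht).trans hs1
    rw [abs_le] at ht1
    rw [Real.norm_eq_abs, abs_le]
    rcases le_total t 0 with h | h <;> simp [h] <;> linarith
  have hgn : ‖g‖ ≤ 1 := hg.norm_le
  have hσ : ‖(2 : ℂ) • p - 1‖ ≤ 1 := by
    rw [two_smul, ← two_mul]
    exact (CStarRing.norm_of_mem_unitary hp.two_mul_sub_one_mem_unitary).le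
  have key : (2 : ℂ) • s - ((2 : ℂ) • p - g) =
      g * (((2 : ℂ) • p - 1) * ((u + w) + (u + w) - 1)) := by
    have e : ((2 : ℂ) • p - 1) * ((u + w) + (u + w) - 1) = (2 : ℂ) • s - ((2 : ℂ) • p - 1) := by
      rw [hsub]
      simp only [two_smul, mul_sub, sub_mul, mul_add, add_mul, hpu, hpw, mul_one, one_mul]
      abel
    rw [e, mul_sub, mul_sub, mul_smul_comm, mul_smul_comm, hgs, hgp, mul_one]
  rw [key]
  calc _ ≤ ‖g‖ * (‖(2 : ℂ) • p - 1‖ * ‖(u + w) + (u + w) - 1‖) :=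
        (norm_mul_le _ _).trans (by gcongr; exact norm_mul_le _ _)
    _ ≤ 1 * (1 * 1) := by gcongr
    _ = 1 := by norm_num


/-- Partial isometries, described by `v v* v = v`. -/
def IsPartialIsometry (v : A) : Prop := v * (star v * v) = v

namespace IsPartialIsometry

variable {v : A}

theorem of_isIdempotentElem (h : IsIdempotentElem (star v * v)) : IsPartialIsometry v := by
  have h1 : star v * (v * (star v * v)) = star v * v := by rw [← mul_assoc]; exact h
  have h2 : star v * v * (star v * (v * (star v * v))) = star v * v := by rw [h1]; exact h
  rw [IsPartialIsometry, ← sub_eq_zero, ← CStarRing.star_mul_self_eq_zero_iff, star_sub, star_mul,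
    star_mul, star_star, sub_mul, mul_sub, mul_sub, mul_assoc, h2, h1, mul_assoc, h, sub_self]

theorem isStarProjection_star_mul (h : IsPartialIsometry v) : IsStarProjection (star v * v) :=
  ⟨by rw [IsIdempotentElem, mul_assoc, show v * (star v * v) = v from h], .star_mul_self v⟩

theorem isStarProjection_mul_star (h : IsPartialIsometry v) : IsStarProjection (v * star v) :=
  ⟨by rw [IsIdempotentElem, mul_assoc, ← mul_assoc (star v), ← mul_assoc,
    show v * (star v * v) = v from h], .mul_star_self v⟩

end IsPartialIsometry

/-- Projections that are not centrally orthogonal have nonzero equivalent subprojections. -/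
theorem IsAWStar.exists_partialIsometry (hAW : IsAWStar A) {r a x : A} (hr : IsStarProjection r)
    (hx : IsStarProjection x) (h : r * a * x ≠ 0) :
    ∃ v : A, v ≠ 0 ∧ IsPartialIsometry v ∧ r * v = v ∧ v * x = v := by
  obtain ⟨p, y, hp, hp0, hys, hyp, hyk, hkp, hpk⟩ := hAW.exists_spectral_projection
    (star_mul_self_nonneg (r * a * x)) (by rwa [Ne, CStarRing.star_mul_self_eq_zero_iff])
  have e : star (r * a * x * y) * (r * a * x * y) = p := by
    rw [star_mul, hys, ← hyk]
    simp only [mul_assoc]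
  have hxp : x * p = p := by
    rw [← hkp, star_mul, hx.isSelfAdjoint.star_eq]
    simp only [← mul_assoc, hx.isIdempotentElem.eq]
  have hpx : p * x = p := by
    simpa [star_mul, hp.isSelfAdjoint.star_eq, hx.isSelfAdjoint.star_eq] using congrArg star hxp
  refine ⟨r * a * x * y, fun h => hp0 (by rw [← e, h, mul_zero]),
    .of_isIdempotentElem (e ▸ hp.isIdempotentElem), ?_, ?_⟩
  · simp only [← mul_assoc, hr.isIdempotentElem.eq]
  · rw [← hyp, mul_assoc _ _ x, mul_assoc y, hpx]

theorem IsAWStar.exists_diagonal_sum_of_isSelfAdjoint (hAW : IsAWStar A) {ι : Type*} {g s : ι → A}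
    (hg : ∀ i, IsStarProjection (g i)) (hgg : ∀ i j, i ≠ j → g i * g j = 0)
    (hs : ∀ i, IsSelfAdjoint (s i)) (hs1 : ∀ i, ‖s i‖ ≤ 1) (hsg : ∀ i, s i * g i = s i) :
    ∃ x, ∀ i, x * g i = s i := by
  have H : ∀ (a : A) (i : ι), IsSelfAdjoint a ∧ ‖a‖ ≤ 1 ∧ a * g i = a → ∃ p : A,
      IsStarProjection p ∧ p * g i = p ∧ ‖(2 : ℂ) • a - ((2 : ℂ) • p - g i)‖ ≤ 1 :=
    fun a i h => hAW.exists_half_symmetry h.1 h.2.1 (hg i) h.2.2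
  choose! P hP using H
  let a : ℕ → ι → A := fun n => Nat.rec s (fun _ b i => (2 : ℂ) • b i - ((2 : ℂ) • P (b i) i - g i)) n
  have ha0 : ∀ i, a 0 i = s i := fun i => rfl
  have hasucc : ∀ n i, a (n + 1) i = (2 : ℂ) • a n i - ((2 : ℂ) • P (a n i) i - g i) :=
    fun n i => rfl
  have h2 : IsSelfAdjoint (2 : ℂ) := by simp
  have ha : ∀ n i, IsSelfAdjoint (a n i) ∧ ‖a n i‖ ≤ 1 ∧ a n i * g i = a n i := by
    intro n
    induction n with
    | zero => exact fun i => ⟨hs i, hs1 i, hsg i⟩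
    | succ n ih =>
      intro i
      obtain ⟨p1, p2, p3⟩ := hP (a n i) i (ih i)
      rw [hasucc]
      refine ⟨(h2.smul (ih i).1).sub ((h2.smul p1.isSelfAdjoint).sub (hg i).isSelfAdjoint), p3, ?_⟩
      rw [sub_mul, sub_mul, smul_mul_assoc, smul_mul_assoc, p2, (ih i).2.2,
        (hg i).isIdempotentElem.eq]
  have hpp : ∀ n, ∃ p : A, IsStarProjection p ∧ ∀ i, p * g i = P (a n i) i := by
    intro n
    obtain ⟨p, hp, h1, h2⟩ := hAW.exists_support (Set.range fun i => P (a n i) i)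
    refine ⟨p, hp, fun i => ?_⟩
    obtain ⟨p1, p2, p3⟩ := hP _ _ (ha n i)
    have e1 : p * P (a n i) i = P (a n i) i := by
      simpa [star_mul, p1.isSelfAdjoint.star_eq, hp.isSelfAdjoint.star_eq] using
        congrArg star (h1 _ ⟨i, rfl⟩)
    have e2 : g i * P (a n i) i = P (a n i) i := by
      simpa [star_mul, p1.isSelfAdjoint.star_eq, (hg i).isSelfAdjoint.star_eq] using
        congrArg star p2
    rw [← e1, ← sub_eq_zero, ← mul_sub]
    refine h2 _ ?_
    rintro _ ⟨j, rfl⟩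
    rcases eq_or_ne j i with rfl | hj
    · simp only [mul_sub, p2, p1.isIdempotentElem.eq, sub_self]
    · have q2 := (hP _ _ (ha n j)).2.1
      dsimp only
      rw [← e2, ← q2]
      simp only [mul_sub]
      rw [mul_assoc, hgg j i hj, mul_assoc, ← mul_assoc (g j), hgg j i hj, zero_mul, sub_self]
  choose p hp hpg using hpp
  obtain ⟨q, hq, h1, -⟩ := hAW.exists_support (Set.range g)
  have hqg : ∀ i, q * g i = g i := fun i => by
    simpa [star_mul, (hg i).isSelfAdjoint.star_eq, hq.isSelfAdjoint.star_eq] using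
        congrArg star (h1 _ ⟨i, rfl⟩)
  have hsum : Summable fun n : ℕ => ((2 : ℂ)⁻¹ ^ (n + 1)) • ((2 : ℂ) • p n - q) := by
    refine Summable.of_norm_bounded (g := fun n : ℕ => (2 : ℝ)⁻¹ ^ n * (2⁻¹ * 3)) ?_ fun n => ?_
    · exact (summable_geometric_of_lt_one (by norm_num) (by norm_num)).mul_right _
    · rw [norm_smul, norm_pow, norm_inv, Complex.norm_ofNat, pow_succ, mul_assoc]
      gcongr
      refine (norm_sub_le _ _).trans ?_
      rw [norm_smul, Complex.norm_ofNat]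
      linarith [hq.norm_le, (hp n).norm_le]
  refine ⟨_, fun i => tendsto_nhds_unique (hsum.hasSum.mul_right (g i)).tendsto_sum_nat ?_⟩
  have tel : ∀ n, ∑ k ∈ Finset.range n, ((2 : ℂ)⁻¹ ^ (k + 1)) • ((2 : ℂ) • p k - q) * g i =
      s i - ((2 : ℂ)⁻¹ ^ n) • a n i := by
    intro n
    induction n with
    | zero => simp [ha0]
    | succ n ih =>
      rw [Finset.sum_range_succ, ih, smul_mul_assoc, sub_mul, smul_mul_assoc, hpg, hqg, hasucc,
        pow_succ]
      module
  simp_rw [tel]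
  conv => rhs; rw [← sub_zero (s i)]
  refine tendsto_const_nhds.sub (squeeze_zero_norm (a := fun n : ℕ => (2 : ℝ)⁻¹ ^ n) (fun n => ?_)
    (tendsto_pow_atTop_nhds_zero_of_lt_one (by norm_num) (by norm_num)))
  rw [norm_smul, norm_pow, norm_inv, Complex.norm_ofNat]
  exact mul_le_of_le_one_right (by positivity) (ha n i).2.1

/-- Bounded block diagonal families along orthogonal projections can be summed. -/
theorem IsAWStar.exists_diagonal_sum (hAW : IsAWStar A) {ι : Type*} {g s : ι → A} {C : ℝ}
    (hg : ∀ i, IsStarProjection (g i)) (hgg : ∀ i j, i ≠ j → g i * g j = 0)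
    (hC : ∀ i, ‖s i‖ ≤ C) (hgs : ∀ i, g i * s i = s i) (hsg : ∀ i, s i * g i = s i) :
    ∃ x, ∀ i, x * g i = s i := by
  obtain ⟨D, hD, hCD⟩ : ∃ D : ℝ, 0 < D ∧ C ≤ D := ⟨max C 1, by positivity, le_max_left _ _⟩
  have hD0 : (D : ℂ) ≠ 0 := by exact_mod_cast hD.ne'
  have hsg' : ∀ i, star (s i) * g i = star (s i) := fun i => by
    simpa [star_mul, (hg i).isSelfAdjoint.star_eq] using congrArg star (hgs i)
  have hn : ∀ i, ‖s i‖ ≤ D := fun i => (hC i).trans hCD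
  obtain ⟨x, hx⟩ := hAW.exists_diagonal_sum_of_isSelfAdjoint (g := g)
    (s := fun i => (2 * D : ℂ)⁻¹ • (s i + star (s i))) hg hgg
    (fun i => by
      rw [isSelfAdjoint_iff]
      simp [star_smul, add_comm])
    (fun i => by
      rw [norm_smul, norm_inv, norm_mul, Complex.norm_ofNat, Complex.norm_real,
        Real.norm_of_nonneg hD.le, inv_mul_le_iff₀ (by positivity)]
      refine (norm_add_le _ _).trans ?_
      rw [norm_star]
      linarith [hn i])
    (fun i => by rw [smul_mul_assoc, add_mul, hsg, hsg'])
  obtain ⟨y, hy⟩ := hAW.exists_diagonal_sum_of_isSelfAdjoint (g := g)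
    (s := fun i => (2 * D : ℂ)⁻¹ • Complex.I • (star (s i) - s i)) hg hgg
    (fun i => by
      rw [isSelfAdjoint_iff]
      simp [star_smul, ← smul_neg])
    (fun i => by
      rw [norm_smul, norm_smul, Complex.norm_I, one_mul, norm_inv, norm_mul, Complex.norm_ofNat,
        Complex.norm_real, Real.norm_of_nonneg hD.le, inv_mul_le_iff₀ (by positivity)]
      refine (norm_sub_le _ _).trans ?_
      rw [norm_star]
      linarith [hn i])
    (fun i => by rw [smul_mul_assoc, smul_mul_assoc, sub_mul, hsg, hsg'])
  refine ⟨(D : ℂ) • (x + Complex.I • y), fun i => ?_⟩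
  rw [smul_mul_assoc, add_mul, smul_mul_assoc, hx, hy, smul_comm Complex.I, smul_smul Complex.I,
    Complex.I_mul_I, ← smul_add, smul_smul, mul_inv, mul_comm, mul_assoc, inv_mul_cancel₀ hD0]
  module

theorem IsStarProjection.star_mul_eq {e x : A} (he : IsStarProjection e) (h : x * e = x) :
    e * star x = star x := by
  simpa [star_mul, he.isSelfAdjoint.star_eq] using congrArg star h

theorem IsStarProjection.mul_eq_of_star_mul_eq {e x : A} (he : IsStarProjection e)
    (h : star x * e = star x) : e * x = x := by
  simpa using he.star_mul_eq h

theorem IsStarProjection.mul_eq_zero_comm {e f : A} (he : IsStarProjection e)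
    (hf : IsStarProjection f) (h : e * f = 0) : f * e = 0 := by
  simpa [star_mul, he.isSelfAdjoint.star_eq, hf.isSelfAdjoint.star_eq] using congrArg star h

theorem IsStarProjection.mul_eq_comm {e f : A} (he : IsStarProjection e)
    (hf : IsStarProjection f) (h : e * f = e) : f * e = e := by
  simpa [star_mul, he.isSelfAdjoint.star_eq, hf.isSelfAdjoint.star_eq] using congrArg star h

theorem IsStarProjection.mul_eq_comm' {e f : A} (he : IsStarProjection e)
    (hf : IsStarProjection f) (h : f * e = e) : e * f = e := by
  simpa [star_mul, he.isSelfAdjoint.star_eq, hf.isSelfAdjoint.star_eq] using congrArg star h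

/-- Bounded families of columns with orthogonal supports and orthogonal ranges can be summed. -/
theorem IsAWStar.exists_column_sum (hAW : IsAWStar A) {ι : Type*} {e x : ι → A} {C : ℝ}
    (he : ∀ i, IsStarProjection (e i)) (hee : ∀ i j, i ≠ j → e i * e j = 0)
    (hC : ∀ i, ‖x i‖ ≤ C) (hxe : ∀ i, x i * e i = x i)
    (hxx : ∀ i j, i ≠ j → star (x i) * x j = 0) (hex : ∀ i j, e j * x i = 0) :
    ∃ y, ∀ i, y * e i = x i := by
  choose f hf hxf hfa using fun i => hAW.exists_support {star (x i)}
  have hfx : ∀ i, f i * x i = x i := fun i => (hf i).mul_eq_of_star_mul_eq (hxf i _ rfl)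
  have hfe : ∀ i j, f i * e j = 0 := fun i j => hfa i _ (by
    rintro _ rfl
    simpa [star_mul, (he j).isSelfAdjoint.star_eq] using congrArg star (hex i j))
  have hef : ∀ i j, e j * f i = 0 := fun i j => (hf i).mul_eq_zero_comm (he j) (hfe i j)
  have hff : ∀ i j, i ≠ j → f i * f j = 0 := fun i j hij => by
    refine (hf j).mul_eq_zero_comm (hf i) (hfa j _ ?_)
    rintro _ rfl
    have : f i * x j = 0 := hfa i _ (by rintro _ rfl; exact hxx i j hij)
    simpa [star_mul, (hf i).isSelfAdjoint.star_eq] using congrArg star this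
  obtain ⟨y, hy⟩ := hAW.exists_diagonal_sum (g := fun i => e i + f i) (s := x) (C := C)
    (fun i => (he i).add (hf i) (hef i i))
    (fun i j hij => by simp [add_mul, mul_add, hee i j hij, hef, hfe, hff i j hij])
    hC (fun i => by rw [add_mul, hex, hfx, zero_add])
    (fun i => by rw [mul_add, hxe, ← hxe, mul_assoc, hef, mul_zero, add_zero])
  refine ⟨y, fun i => ?_⟩
  have := congrArg (· * e i) (hy i)
  simpa [mul_assoc, add_mul, (he i).isIdempotentElem.eq, hfe, hxe] using this

/-- A bounded module map on a right ideal. -/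
structure IsBoundedModuleMap (I : Submodule ℂ A) (f : A → A) : Prop where
  map_add : ∀ x ∈ I, ∀ y ∈ I, f (x + y) = f x + f y
  map_mul : ∀ x ∈ I, ∀ r : A, f (x * r) = f x * r
  bounded : ∃ C : ℝ, 0 ≤ C ∧ ∀ x ∈ I, ‖f x‖ ≤ C * ‖x‖

namespace IsBoundedModuleMap

variable {I : Submodule ℂ A} {f g : A → A}

theorem map_smul (hf : IsBoundedModuleMap I f) {x : A} (hx : x ∈ I) (c : ℂ) :
    f (c • x) = c • f x := by
  simpa using hf.map_mul x hx (c • 1)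

theorem map_zero (hf : IsBoundedModuleMap I f) : f 0 = 0 := by
  simpa using hf.map_smul I.zero_mem 0

theorem mul_left (hf : IsBoundedModuleMap I f) (b : A) :
    IsBoundedModuleMap I fun x => b * f x where
  map_add x hx y hy := by simp [hf.map_add x hx y hy, mul_add]
  map_mul x hx r := by simp [hf.map_mul x hx r, mul_assoc]
  bounded := by
    obtain ⟨C, hC, h⟩ := hf.bounded
    exact ⟨‖b‖ * C, by positivity, fun x hx => (norm_mul_le _ _).trans
      (by rw [mul_assoc]; gcongr; exact h x hx)⟩

theorem sub (hf : IsBoundedModuleMap I f) (hg : IsBoundedModuleMap I g) :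
    IsBoundedModuleMap I fun x => f x - g x where
  map_add x hx y hy := by simp only [hf.map_add x hx y hy, hg.map_add x hx y hy]; abel
  map_mul x hx r := by simp [hf.map_mul x hx r, hg.map_mul x hx r, sub_mul]
  bounded := by
    obtain ⟨C, hC, h⟩ := hf.bounded
    obtain ⟨D, hD, h'⟩ := hg.bounded
    exact ⟨C + D, by positivity, fun x hx => (norm_sub_le _ _).trans
      (by rw [add_mul]; exact add_le_add (h x hx) (h' x hx))⟩

theorem const_mul (I : Submodule ℂ A) (c : A) : IsBoundedModuleMap I fun x => c * x where
  map_add _ _ _ _ := mul_add _ _ _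
  map_mul _ _ _ := (mul_assoc _ _ _).symm
  bounded := ⟨‖c‖, norm_nonneg _, fun _ _ => norm_mul_le _ _⟩

/-- Bounded module maps satisfy an operator-valued norm inequality. -/
theorem star_mul_self_le (hf : IsBoundedModuleMap I f) (hI : IsRightIdeal I) :
    ∃ C : ℝ, 0 ≤ C ∧ ∀ h ∈ I, star (f h) * f h ≤ C • (star h * h) := by
  obtain ⟨C, hC, hfC⟩ := hf.bounded
  refine ⟨C ^ 2, by positivity, fun h hh => ?_⟩
  set k := star h * h with hk
  have hk0 : 0 ≤ k := star_mul_self_nonneg h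
  have hks : IsSelfAdjoint k := .of_nonneg hk0
  have main : ∀ ε : ℝ, 0 < ε → star (f h) * f h ≤ C ^ 2 • (k + algebraMap ℝ A ε) := by
    intro ε hε
    obtain ⟨H, G, hH, hG, hHG, hHH, hGG⟩ : ∃ H G : ℝ → ℝ, Continuous H ∧ Continuous G ∧
        (∀ t, G t * H t = 1) ∧ (∀ t, 0 ≤ t → H t * H t = t + ε) ∧
        ∀ t, 0 ≤ t → ‖G t * t * G t‖ ≤ 1 := by
      have hpos : ∀ t : ℝ, 0 < |t| + ε := fun t => by positivity
      refine ⟨fun t => √(|t| + ε), fun t => (√(|t| + ε))⁻¹, by fun_prop,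
        Continuous.inv₀ (by fun_prop) fun t => (Real.sqrt_pos.2 (hpos t)).ne',
        fun t => inv_mul_cancel₀ (Real.sqrt_pos.2 (hpos t)).ne', fun t ht => ?_, fun t ht => ?_⟩
      · dsimp only
        rw [Real.mul_self_sqrt (hpos t).le, abs_of_nonneg ht]
      · dsimp only
        rw [mul_right_comm, ← mul_inv, Real.mul_self_sqrt (hpos t).le, abs_of_nonneg ht,
          Real.norm_of_nonneg (by positivity), inv_mul_le_iff₀ (by positivity)]
        linarith
    set Y := cfc G k
    set Z := cfc H k
    have hYs : star Y = Y := (cfc_predicate _ k : IsSelfAdjoint Y)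
    have hZs : star Z = Z := (cfc_predicate _ k : IsSelfAdjoint Z)
    have hYZ : Y * Z = 1 := by
      rw [← cfc_mul .., ← cfc_one ℝ k]
      exact cfc_congr fun t _ => hHG t
    have hZZ : Z * Z = k + algebraMap ℝ A ε := by
      have : k + algebraMap ℝ A ε = cfc (fun t : ℝ => t + ε) k := by
        rw [cfc_add .., cfc_const .., cfc_id' ..]
      rw [this, ← cfc_mul ..]
      exact cfc_congr fun t ht => hHH t (spectrum_nonneg_of_nonneg hk0 ht)
    have hYkY : ‖Y * k * Y‖ ≤ 1 := by
      have : Y * k * Y = cfc (fun t => G t * t * G t) k := by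
        rw [cfc_mul .., cfc_mul .., cfc_id' ..]
      rw [this]
      exact norm_cfc_le zero_le_one fun t ht => hGG t (spectrum_nonneg_of_nonneg hk0 ht)
    have hhY : ‖h * Y‖ ≤ 1 := by
      have : ‖h * Y‖ * ‖h * Y‖ ≤ 1 := by
        rw [← CStarRing.norm_star_mul_self, star_mul, hYs, mul_assoc, ← mul_assoc (star h),
          ← mul_assoc]
        exact hYkY
      nlinarith [norm_nonneg (h * Y)]
    have h1 : ‖f h * Y‖ ≤ C := by
      rw [← hf.map_mul h hh]
      exact (hfC _ (hI _ hh _)).trans (mul_le_of_le_one_right hC hhY)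
    have h2 : star (f h * Y) * (f h * Y) ≤ algebraMap ℝ A (C ^ 2) :=
      CStarAlgebra.star_mul_le_algebraMap_norm_sq.trans
        (algebraMap_mono A (pow_le_pow_left₀ (norm_nonneg _) h1 2))
    have h3 := star_left_conjugate_le_conjugate h2 Z
    have e1 : f h * Y * Z = f h := by rw [mul_assoc, hYZ, mul_one]
    rw [← mul_assoc, ← star_mul, e1, mul_assoc, e1, hZs, ← Algebra.commutes, mul_assoc, hZZ,
      ← Algebra.smul_def] at h3
    exact h3
  have lim : Tendsto (fun ε : ℝ => C ^ 2 • (k + algebraMap ℝ A ε)) (𝓝[>] 0) (𝓝 (C ^ 2 • k)) := by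
    have : Continuous fun ε : ℝ => C ^ 2 • (k + algebraMap ℝ A ε) := by fun_prop
    simpa using (this.tendsto 0).mono_left nhdsWithin_le_nhds
  exact ge_of_tendsto lim (eventually_mem_nhdsWithin.mono fun ε hε => main ε hε)

/-- A bounded module map vanishing at `k ≥ 0` vanishes at every `y` with `y y* ≤ k`. -/
theorem eq_zero_of_mul_star_le (hf : IsBoundedModuleMap I f) (hI : IsRightIdeal I) {k y : A}
    (hk0 : 0 ≤ k) (hkI : k ∈ I) (hfk : f k = 0) (hy : y ∈ I) (hyk : y * star y ≤ k) :
    f y = 0 := by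
  obtain ⟨C, hC, hfC⟩ := hf.bounded
  have hks : IsSelfAdjoint k := .of_nonneg hk0
  have main : ∀ ε : ℝ, 0 < ε → ‖f y‖ * ‖f y‖ ≤ C * C * ε := by
    intro ε hε
    obtain ⟨r, hr⟩ : ∃ r, ‖(1 - k * r) * k * star (1 - k * r)‖ ≤ ε := by
      obtain ⟨G, hG, hGt⟩ : ∃ G : ℝ → ℝ, Continuous G ∧
          ∀ t, 0 ≤ t → ‖(1 - t * G t) * t * (1 - t * G t)‖ ≤ ε := by
        have hpos : ∀ t : ℝ, 0 < |t| + ε := fun t => by positivity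
        refine ⟨fun t => (|t| + ε)⁻¹, Continuous.inv₀ (by fun_prop) fun t => (hpos t).ne',
          fun t ht => ?_⟩
        dsimp only
        rw [abs_of_nonneg ht]
        have h1 : 1 - t * (t + ε)⁻¹ = ε * (t + ε)⁻¹ := by field_simp; ring
        rw [h1, Real.norm_of_nonneg (by positivity)]
        have h2 : ε * (t + ε)⁻¹ ≤ 1 := by
          rw [mul_inv_le_iff₀ (by positivity)]; linarith
        have h3 : t * (ε * (t + ε)⁻¹) ≤ ε := by
          rw [← mul_assoc, mul_inv_le_iff₀ (by positivity)]; nlinarith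
        calc _ = ε * (t + ε)⁻¹ * (t * (ε * (t + ε)⁻¹)) := by ring
          _ ≤ 1 * ε := by gcongr
          _ = ε := one_mul _
      refine ⟨cfc G k, ?_⟩
      have e : 1 - k * cfc G k = cfc (fun t => 1 - t * G t) k := by
        rw [cfc_sub .., cfc_mul .., cfc_id' .., cfc_const_one ..]
      have es : star (cfc (fun t => 1 - t * G t) k) = cfc (fun t => 1 - t * G t) k :=
        (cfc_predicate _ k : IsSelfAdjoint _)
      have e2 : cfc (fun t => 1 - t * G t) k * k * cfc (fun t => 1 - t * G t) k =
          cfc (fun t => (1 - t * G t) * t * (1 - t * G t)) k := by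
        rw [cfc_mul (fun t => (1 - t * G t) * t) .., cfc_mul (fun t => 1 - t * G t) (fun t => t) ..,
          cfc_id' ..]
      rw [e, es, e2]
      exact norm_cfc_le hε.le fun t ht => hGt t (spectrum_nonneg_of_nonneg hk0 ht)
    have h1 : ‖(1 - k * r) * y‖ * ‖(1 - k * r) * y‖ ≤ ε := by
      rw [← CStarRing.norm_self_mul_star, star_mul, mul_assoc, ← mul_assoc y, ← mul_assoc]
      refine le_trans (CStarAlgebra.norm_le_norm_of_nonneg_of_le ?_ ?_) hr
      · exact star_right_conjugate_nonneg (mul_star_self_nonneg y) _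
      · exact star_right_conjugate_le_conjugate hyk _
    have hmem : k * (r * y) ∈ I := hI _ hkI _
    have hz : (1 - k * r) * y ∈ I := by
      rw [sub_mul, one_mul, mul_assoc]
      exact I.sub_mem hy hmem
    have h2 : f y = f ((1 - k * r) * y) := by
      have : y = (1 - k * r) * y + k * (r * y) := by noncomm_ring
      conv_lhs => rw [this, hf.map_add _ hz _ hmem, hf.map_mul _ hkI, hfk, zero_mul, add_zero]
    rw [h2]
    calc _ ≤ (C * ‖(1 - k * r) * y‖) * (C * ‖(1 - k * r) * y‖) := by gcongr <;> exact hfC _ hz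
      _ = C * C * (‖(1 - k * r) * y‖ * ‖(1 - k * r) * y‖) := by ring
      _ ≤ _ := by gcongr
  have lim : Tendsto (fun ε : ℝ => C * C * ε) (𝓝[>] 0) (𝓝 0) := by
    have : Continuous fun ε : ℝ => C * C * ε := by fun_prop
    simpa using (this.tendsto 0).mono_left nhdsWithin_le_nhds
  have := ge_of_tendsto lim (eventually_mem_nhdsWithin.mono fun ε hε => main ε hε)
  exact norm_eq_zero.1 (mul_self_eq_zero.1 (this.antisymm (mul_self_nonneg _)))

end IsBoundedModuleMap

theorem exists_weighted_sum {I : Submodule ℂ A} (hIc : IsClosed (I : Set A)) {ι : Type*}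
    [Countable ι] {x : ι → A} (hx : ∀ i, IsStarProjection (x i))
    (hxx : ∀ i j, i ≠ j → x i * x j = 0) (hxI : ∀ i, x i ∈ I) :
    ∃ h ∈ I, ∃ w : ι → ℝ, (∀ i, 0 < w i) ∧ (∀ i, h * x i = w i • x i) ∧
      ∀ a, (∀ i, x i * a = 0) → h * a = 0 := by
  have := Encodable.ofCountable ι
  obtain ⟨w, hw, c, hc, -⟩ := posSumOfEncodable (ε := 1) one_pos ι
  have hsum : Summable fun i => w i • x i := by
    refine Summable.of_norm_bounded hc.summable fun i => ?_
    rw [norm_smul, Real.norm_of_nonneg (hw i).le]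
    exact mul_le_of_le_one_right (hw i).le (hx i).norm_le
  refine ⟨∑' i, w i • x i, ?_, w, hw, fun j => ?_, fun a ha => ?_⟩
  · exact hIc.mem_of_tendsto hsum.hasSum (Eventually.of_forall fun s =>
      I.sum_mem fun i _ => I.smul_of_tower_mem _ (hxI i))
  · refine (hsum.hasSum.mul_right (x j)).unique ?_
    have := hasSum_single (f := fun i => w i • x i * x j) j fun i hi => by
      simp [hxx i j hi]
    simpa [smul_mul_assoc, (hx j).isIdempotentElem.eq] using this
  · refine (hsum.hasSum.mul_right a).unique ?_
    simp [ha, hasSum_zero]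

/-- A module map whose values avoid an isometric copy of the supports is implemented by an
element on the given orthogonal projections. -/
theorem IsAWStar.exists_implementing_of_isometry (hAW : IsAWStar A) {I : Submodule ℂ A}
    (hI : IsRightIdeal I) (hIc : IsClosed (I : Set A)) {g : A → A} (hg : IsBoundedModuleMap I g)
    {ι : Type*} [Countable ι] {x : ι → A} (hx : ∀ i, IsStarProjection (x i))
    (hxx : ∀ i j, i ≠ j → x i * x j = 0) (hxI : ∀ i, x i ∈ I) {q V : A}
    (hxq : ∀ i, x i * q = x i) (hV : star V * V = q) (hxV : ∀ i, x i * V = 0)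
    (hVg : ∀ y ∈ I, star V * g y = 0) (hxg : ∀ i, ∀ y ∈ I, x i * g y = 0) :
    ∃ B, ∀ i, B * x i = g (x i) := by
  obtain ⟨h, hhI, w, hw, hhx, hha⟩ := exists_weighted_sum hIc hx hxx hxI
  obtain ⟨C, hC, hgC⟩ := hg.star_mul_self_le hI
  set a := g h with ha
  have hax : ∀ i, a * x i = w i • g (x i) := fun i => by
    have : w i • x i = x i * algebraMap ℝ A (w i) := by
      rw [Algebra.smul_def, Algebra.commutes]
    rw [ha, ← hg.map_mul h hhI, hhx, this, hg.map_mul _ (hxI i), ← Algebra.commutes,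
      ← Algebra.smul_def]
  have hhq : h * (1 - q) = 0 := hha _ fun i => by rw [mul_sub, hxq, mul_one, sub_self]
  have haq : a * (1 - q) = 0 := by rw [ha, ← hg.map_mul h hhI, hhq, hg.map_zero]
  have hpos : 0 ≤ C • (star h * h) - star a * a := sub_nonneg.2 (hgC h hhI)
  set b := CFC.sqrt (C • (star h * h) - star a * a) with hb
  have hbb : b * b = C • (star h * h) - star a * a := CFC.sqrt_mul_sqrt_self _ hpos
  have hbs : star b = b := (CFC.sqrt_nonneg _ : 0 ≤ b).isSelfAdjoint
  have hbq : b * (1 - q) = 0 := mul_eq_zero_of_star_mul_mul (by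
    rw [hbs, hbb, sub_mul, smul_mul_assoc, mul_assoc, hhq, mul_assoc, haq]; simp)
  have hbq' : b * q = b := by
    rw [mul_sub, mul_one, sub_eq_zero] at hbq; exact hbq.symm
  have hqs : star q = q := by rw [← hV]; simp
  have hqb : q * b = b := by simpa [star_mul, hbs, hqs] using congrArg star hbq'
  have hVa : star V * a = 0 := hVg h hhI
  have haV : star a * V = 0 := by simpa using congrArg star hVa
  have hsq : star (a + V * b) * (a + V * b) = C • (star h * h) := by
    have e1 : star (a + V * b) * (a + V * b) = star a * a + star a * V * b + b * (star V * a) +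
        b * (star V * V) * b := by
      rw [star_add, star_mul, hbs]; noncomm_ring
    rw [e1, haV, hVa, hV, hbq', hbb]
    simp
  have hWW : ∀ i j, star ((w i)⁻¹ • ((a + V * b) * x i)) * ((w j)⁻¹ • ((a + V * b) * x j)) =
      C • (x i * x j) := fun i j => by
    have e2 : star ((w i)⁻¹ • ((a + V * b) * x i)) * ((w j)⁻¹ • ((a + V * b) * x j)) =
        ((w i)⁻¹ * (w j)⁻¹) • (x i * (star (a + V * b) * (a + V * b)) * x j) := by
      rw [star_smul, star_trivial, star_mul (a + V * b), (hx i).isSelfAdjoint.star_eq,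
        smul_mul_smul_comm]
      simp only [mul_assoc]
    have e3 : x i * star h = w i • x i := by
      have := congrArg star (hhx i)
      rwa [star_mul, star_smul, star_trivial (w i), (hx i).isSelfAdjoint.star_eq] at this
    rw [e2, hsq, mul_smul_comm, smul_mul_assoc, ← mul_assoc, e3, mul_assoc, hhx,
      smul_mul_smul_comm, smul_smul, smul_smul]
    congr 1
    have := (hw i).ne'
    have := (hw j).ne'
    field_simp
  obtain ⟨B, hB⟩ := hAW.exists_column_sum (e := x)
    (x := fun i => (w i)⁻¹ • ((a + V * b) * x i)) (C := √C) hx hxx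
    (fun i => by
      refine Real.le_sqrt_of_sq_le ?_
      rw [sq, ← CStarRing.norm_star_mul_self, hWW, (hx i).isIdempotentElem.eq, norm_smul,
        Real.norm_of_nonneg hC]
      exact mul_le_of_le_one_right hC (hx i).norm_le)
    (fun i => by rw [smul_mul_assoc, mul_assoc, (hx i).isIdempotentElem.eq])
    (fun i j hij => by rw [hWW, hxx i j hij, smul_zero])
    (fun i j => by
      rw [mul_smul_comm, ← mul_assoc, mul_add, hxg j h hhI, ← mul_assoc, hxV]
      simp)
  refine ⟨(1 - V * star V) * B, fun i => ?_⟩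
  have e4 : (1 - V * star V) * (a + V * b) = a := by
    have : (1 - V * star V) * (a + V * b) = a + V * b - V * (star V * a) -
      V * (star V * V * b) := by noncomm_ring
    rw [this, hVa, hV, hqb]
    simp
  rw [mul_assoc, hB, mul_smul_comm, ← mul_assoc, e4, hax, smul_smul, inv_mul_cancel₀ (hw i).ne',
    one_smul]

theorem mul_eq_self_of_star_mul_self_eq {x u : A} (hx : IsStarProjection x) (h : star u * u = x) :
    u * x = u := by
  subst h
  exact IsPartialIsometry.of_isIdempotentElem hx.isIdempotentElem

/-- The support of a family of projections. -/
structure IsSupport {ι : Type*} (x : ι → A) (q : A) : Prop where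
  isStarProjection : IsStarProjection q
  mul_eq : ∀ i, x i * q = x i
  mul_eq_zero : ∀ a, (∀ i, x i * a = 0) → q * a = 0

theorem IsAWStar.exists_isSupport (hAW : IsAWStar A) {ι : Type*} (x : ι → A) :
    ∃ q, IsSupport x q := by
  obtain ⟨q, hq, h1, h2⟩ := hAW.exists_support (Set.range x)
  exact ⟨q, hq, fun i => h1 _ ⟨i, rfl⟩, fun a ha => h2 a (by rintro _ ⟨i, rfl⟩; exact ha i)⟩

namespace IsSupport

variable {ι : Type*} {x : ι → A} {q : A}

theorem mul_eq' (hq : IsSupport x q) (hx : ∀ i, IsStarProjection (x i)) (i : ι) :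
    q * x i = x i :=
  (hx i).mul_eq_comm hq.isStarProjection (hq.mul_eq i)

theorem mul_support_eq_zero (hq : IsSupport x q) (hx : ∀ i, IsStarProjection (x i)) {a : A}
    (h : ∀ i, a * x i = 0) : a * q = 0 := by
  have := hq.mul_eq_zero (star a) fun i => by
    simpa [star_mul, (hx i).isSelfAdjoint.star_eq] using congrArg star (h i)
  simpa [star_mul, hq.isStarProjection.isSelfAdjoint.star_eq] using congrArg star this

theorem mul_mul_support_eq_zero {κ : Type*} {y : κ → A} {r : A} (hr : IsSupport y r)
    (hq : IsSupport x q) (hx : ∀ i, IsStarProjection (x i)) {a : A}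
    (h : ∀ j i, y j * a * x i = 0) : r * a * q = 0 := by
  rw [mul_assoc]
  refine hr.mul_eq_zero _ fun j => ?_
  rw [← mul_assoc]
  exact hq.mul_support_eq_zero hx (h j)

end IsSupport

/-- Orthogonal partial isometries with initial projections `x i` can be summed. -/
theorem IsAWStar.exists_isometry_sum (hAW : IsAWStar A) {ι : Type*} {x u : ι → A} {q : A}
    (hq : IsSupport x q) (hx : ∀ i, IsStarProjection (x i))
    (hxx : ∀ i j, i ≠ j → x i * x j = 0) (hu : ∀ i, star (u i) * u i = x i)
    (huu : ∀ i j, i ≠ j → star (u i) * u j = 0) (hxu : ∀ i j, x j * u i = 0) :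
    ∃ V, star V * V = q ∧ V * q = V ∧ (∀ i, V * x i = u i) ∧ ∀ i, x i * V = 0 := by
  have hux : ∀ i, u i * x i = u i := fun i => mul_eq_self_of_star_mul_self_eq (hx i) (hu i)
  obtain ⟨V, hV⟩ := hAW.exists_column_sum (C := 1) hx hxx
    (fun i => by
      have := (hx i).norm_le
      rw [← hu, CStarRing.norm_star_mul_self] at this
      nlinarith [norm_nonneg (u i)]) hux huu hxu
  have hqq := hq.isStarProjection.isIdempotentElem.eq
  have hqs := hq.isStarProjection.isSelfAdjoint.star_eq
  have hVx : ∀ i, V * q * x i = u i := fun i => by rw [mul_assoc, hq.mul_eq' hx, hV]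
  refine ⟨V * q, ?_, by rw [mul_assoc, hqq], hVx, fun i => ?_⟩
  · have h0 : q * (star V * V - 1) * q = 0 := by
      refine hq.mul_mul_support_eq_zero hq hx fun j i => ?_
      have e : x j * (star V * V - 1) * x i = star (V * x j) * (V * x i) - x j * x i := by
        rw [star_mul, (hx j).isSelfAdjoint.star_eq]; noncomm_ring
      rw [e, hV, hV]
      rcases eq_or_ne j i with rfl | hji
      · rw [hu, (hx j).isIdempotentElem.eq, sub_self]
      · rw [huu j i hji, hxx j i hji, sub_self]
    rw [← sub_eq_zero, ← h0, star_mul, hqs]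
    have : q * (star V * V - 1) * q = q * star V * (V * q) - q * q := by noncomm_ring
    rw [this, hqq]
  · rw [← mul_assoc]
    exact hq.mul_support_eq_zero hx fun j => by rw [mul_assoc, hV, hxu]

/-- A bounded module map is implemented on a family of projections having two further orthogonal
copies. -/
theorem IsAWStar.exists_implementing_of_copies (hAW : IsAWStar A) {I : Submodule ℂ A}
    (hI : IsRightIdeal I) (hIc : IsClosed (I : Set A)) {f : A → A} (hf : IsBoundedModuleMap I f)
    {ι : Type*} [Countable ι] {x u v : ι → A} (hx : ∀ i, IsStarProjection (x i))
    (hxx : ∀ i j, i ≠ j → x i * x j = 0) (hxI : ∀ i, x i ∈ I)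
    (hu : ∀ i, star (u i) * u i = x i) (hv : ∀ i, star (v i) * v i = x i)
    (huu : ∀ i j, i ≠ j → star (u i) * u j = 0) (hvv : ∀ i j, i ≠ j → star (v i) * v j = 0)
    (hxu : ∀ i j, x j * u i = 0) (hxv : ∀ i j, x j * v i = 0)
    (hvu : ∀ i j, star (v j) * u i = 0) :
    ∃ b, ∀ i, b * x i = f (x i) := by
  obtain ⟨q, hq⟩ := hAW.exists_isSupport x
  obtain ⟨V, hV, hVq, hVx, hxV⟩ := hAW.exists_isometry_sum hq hx hxx hu huu hxu
  obtain ⟨W, hW, hWq, hWx, hxW⟩ := hAW.exists_isometry_sum hq hx hxx hv hvv hxv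
  have hqs := hq.isStarProjection.isSelfAdjoint.star_eq
  have hqV : star V * q = 0 := by
    simpa [star_mul, hqs] using congrArg star (hq.mul_eq_zero V hxV)
  have hVV : star V * V * star V = star V := by
    rw [hV]; simpa [star_mul, hqs] using congrArg star hVq
  have hWV : star W * V = 0 := by
    have : q * (star W * V) * q = 0 := hq.mul_mul_support_eq_zero hq hx fun j i => by
      have : x j * (star W * V) * x i = star (W * x j) * (V * x i) := by
        rw [star_mul, (hx j).isSelfAdjoint.star_eq]; simp only [mul_assoc]
      rw [this, hVx, hWx, hvu]
    have e : q * star W = star W := by simpa [star_mul, hqs] using congrArg star hWq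
    rw [← this, ← mul_assoc, e, mul_assoc, hVq]
  obtain ⟨B₁, h₁⟩ := hAW.exists_implementing_of_isometry hI hIc
    (hf.mul_left (1 - q - V * star V)) hx hxx hxI hq.mul_eq hV hxV
    (fun y _ => by
      rw [← mul_assoc, mul_sub, mul_sub, hqV, ← mul_assoc, hVV]; simp)
    (fun i y _ => by
      rw [← mul_assoc, mul_sub, mul_sub, hq.mul_eq, ← mul_assoc, hxV]; simp)
  obtain ⟨B₂, h₂⟩ := hAW.exists_implementing_of_isometry hI hIc
    (hf.mul_left (V * star V)) hx hxx hxI hq.mul_eq hW hxW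
    (fun y _ => by rw [← mul_assoc, ← mul_assoc, hWV]; simp)
    (fun i y _ => by rw [← mul_assoc, ← mul_assoc, hxV]; simp)
  obtain ⟨B₃, h₃⟩ := hAW.exists_implementing_of_isometry hI hIc
    (hf.mul_left V) hx hxx hxI hq.mul_eq hW hxW
    (fun y _ => by rw [← mul_assoc, hWV]; simp)
    (fun i y _ => by rw [← mul_assoc, hxV]; simp)
  refine ⟨B₁ + B₂ + star V * B₃, fun i => ?_⟩
  rw [add_mul, add_mul, mul_assoc, h₁, h₂, h₃, ← mul_assoc (star V), hV]
  noncomm_ring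

/-- A bounded module map is implemented on centrally orthogonal projections. -/
theorem IsAWStar.exists_implementing_of_centrally_orthogonal (hAW : IsAWStar A)
    {I : Submodule ℂ A} {f : A → A} (hf : IsBoundedModuleMap I f)
    {ι : Type*} {x : ι → A} (hx : ∀ i, IsStarProjection (x i)) (hxI : ∀ i, x i ∈ I)
    (hxx : ∀ i j, i ≠ j → x i * x j = 0) (hxax : ∀ i j, i ≠ j → ∀ a, x i * a * x j = 0) :
    ∃ b, ∀ i, b * x i = f (x i) := by
  obtain ⟨q, hq⟩ := hAW.exists_isSupport x
  obtain ⟨C, hC, hfC⟩ := hf.bounded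
  have hfx : ∀ i, f (x i) * x i = f (x i) := fun i => by
    rw [← hf.map_mul _ (hxI i), (hx i).isIdempotentElem.eq]
  have hfb : ∀ i, ‖f (x i)‖ ≤ C := fun i =>
    (hfC _ (hxI i)).trans (mul_le_of_le_one_right hC (hx i).norm_le)
  have hqs := hq.isStarProjection.isSelfAdjoint.star_eq
  obtain ⟨b, hb⟩ := hAW.exists_column_sum (e := x) (x := fun i => (1 - q) * f (x i)) (C := 1 * C)
    hx hxx
    (fun i => (norm_mul_le _ _).trans
      (mul_le_mul hq.isStarProjection.one_sub.norm_le (hfb i) (norm_nonneg _) zero_le_one))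
    (fun i => by rw [mul_assoc, hfx])
    (fun i j hij => by
      have := hxax i j hij (star (f (x i)) * star (1 - q) * (1 - q) * f (x j))
      rw [star_mul, ← hfx i, ← hfx j, star_mul, (hx i).isSelfAdjoint.star_eq]
      simpa only [mul_assoc] using this)
    (fun i j => by rw [← mul_assoc, mul_sub, hq.mul_eq]; simp)
  obtain ⟨c, hc⟩ := hAW.exists_diagonal_sum (g := x) (s := fun i => x i * f (x i)) (C := 1 * C)
    hx hxx
    (fun i => (norm_mul_le _ _).trans
      (mul_le_mul (hx i).norm_le (hfb i) (norm_nonneg _) zero_le_one))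
    (fun i => by rw [← mul_assoc, (hx i).isIdempotentElem.eq])
    (fun i => by rw [mul_assoc, hfx])
  refine ⟨b + c, fun i => ?_⟩
  have : q * ((1 - x i) * f (x i)) = 0 := hq.mul_eq_zero _ fun j => by
    rcases eq_or_ne j i with rfl | hji
    · rw [← mul_assoc, mul_sub, (hx j).isIdempotentElem.eq]; simp
    · rw [← hfx i, ← mul_assoc, ← mul_assoc]
      simpa only [mul_assoc] using hxax j i hji ((1 - x i) * f (x i))
  rw [sub_mul, one_mul, mul_sub, sub_eq_zero, ← mul_assoc, hq.mul_eq' hx] at this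
  rw [add_mul, hb, hc, ← this]
  noncomm_ring

theorem exists_maximal_pairwise {α : Type*} (P : α → Prop) (R : α → α → Prop) :
    ∃ S : Set α, (∀ s ∈ S, P s) ∧ S.Pairwise R ∧
      ∀ a, P a → (∀ s ∈ S, R a s ∧ R s a) → a ∈ S := by
  obtain ⟨S, hS⟩ := zorn_subset {S : Set α | (∀ s ∈ S, P s) ∧ S.Pairwise R} fun c hc hchain =>
    ⟨⋃₀ c, ⟨fun s ⟨t, ht, hs⟩ => (hc ht).1 s hs,
      (Set.pairwise_sUnion hchain.directedOn).2 fun t ht => (hc ht).2⟩,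
      fun t ht => Set.subset_sUnion_of_mem ht⟩
  refine ⟨S, hS.prop.1, hS.prop.2, fun a ha haS => ?_⟩
  refine hS.le_of_ge (y := insert a S) ⟨?_, ?_⟩ (Set.subset_insert a S) (Set.mem_insert a S)
  · rintro s (rfl | hs)
    exacts [ha, hS.prop.1 s hs]
  · exact Set.pairwise_insert.2 ⟨hS.prop.2, fun b hb _ => haS b hb⟩

theorem SigmaFiniteAlg.countable (hsf : SigmaFiniteAlg A) {S : Set A}
    (hS : ∀ p ∈ S, IsStarProjection p ∧ p ≠ 0) (hSS : S.Pairwise fun p q => p * q = 0) :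
    S.Countable :=
  hsf S (fun p hp => ⟨(hS p hp).1.isSelfAdjoint, (hS p hp).1.isIdempotentElem, (hS p hp).2⟩)
    fun _ hp _ hq hpq => hSS hp hq hpq

theorem mul_eq_zero_of_add_mul_eq_zero {k x b : A} (hk : 0 ≤ k) (h : (k + x * star x) * b = 0) :
    k * b = 0 ∧ star x * b = 0 := by
  have h0 : star b * k * b + star b * (x * star x) * b = 0 := by
    rw [← add_mul, ← mul_add, mul_assoc, h, mul_zero]
  have h1 : 0 ≤ star b * k * b := star_left_conjugate_nonneg hk b
  have h2 : 0 ≤ star b * (x * star x) * b :=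
    star_left_conjugate_nonneg (mul_star_self_nonneg x) b
  have h4 := (add_eq_zero_iff_of_nonneg h1 h2).1 h0
  have hx : star x * b = 0 := by
    rw [← CStarRing.star_mul_self_eq_zero_iff, ← h4.2]
    simp [mul_assoc]
  refine ⟨?_, hx⟩
  rwa [add_mul, mul_assoc, hx, mul_zero, add_zero] at h

/-- Countably many elements of a closed right ideal are dominated by a positive one. -/
theorem exists_nonneg_mem_of_countable {I : Submodule ℂ A} (hI : IsRightIdeal I)
    (hIc : IsClosed (I : Set A)) {ι : Type*} [Countable ι] {x : ι → A} (hx : ∀ i, x i ∈ I) :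
    ∃ h ∈ I, 0 ≤ h ∧ ∀ b, h * b = 0 → ∀ i, star (x i) * b = 0 := by
  have := Encodable.ofCountable ι
  obtain ⟨w, hw, c, hc, -⟩ := posSumOfEncodable (ε := 1) one_pos ι
  let y : ι → A := fun i => (w i * (‖x i * star (x i)‖ + 1)⁻¹) • (x i * star (x i))
  have hpos : ∀ i, 0 < w i * (‖x i * star (x i)‖ + 1)⁻¹ := fun i =>
    mul_pos (hw i) (by positivity)
  have hy0 : ∀ i, 0 ≤ y i := fun i => smul_nonneg (hpos i).le (mul_star_self_nonneg _)
  have hsum : Summable y := by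
    refine Summable.of_norm_bounded hc.summable fun i => ?_
    rw [norm_smul, Real.norm_of_nonneg (hpos i).le, mul_assoc]
    refine mul_le_of_le_one_right (hw i).le ?_
    rw [inv_mul_le_iff₀ (by positivity)]
    linarith
  refine ⟨∑' i, y i, ?_, tsum_nonneg hy0, fun b hb i => ?_⟩
  · exact hIc.mem_of_tendsto hsum.hasSum (Eventually.of_forall fun s =>
      I.sum_mem fun i _ => I.smul_of_tower_mem _ (hI _ (hx i) _))
  · have h1 : HasSum (fun i => star b * (y i * b)) (star b * ((∑' i, y i) * b)) :=
      (hsum.hasSum.mul_right b).mul_left (star b)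
    rw [hb, mul_zero] at h1
    have h2 := congrFun ((hasSum_zero_iff_of_nonneg fun i => by
      rw [← mul_assoc]; exact star_left_conjugate_nonneg (hy0 i) b).1 h1) i
    simp only [y, smul_mul_assoc, mul_smul_comm, Pi.zero_apply] at h2
    rw [smul_eq_zero_iff_right (hpos i).ne'] at h2
    rw [← CStarRing.star_mul_self_eq_zero_iff, ← h2]
    simp [mul_assoc]

/-- A closed right ideal with zero left annihilator contains a positive element with zero right
annihilator, by σ-finiteness. -/
theorem IsAWStar.exists_nonneg_mem_of_annihilator_eq_zero (hAW : IsAWStar A)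
    (hsf : SigmaFiniteAlg A) {I : Submodule ℂ A} (hI : IsRightIdeal I)
    (hIc : IsClosed (I : Set A)) (hann : ∀ b : A, (∀ x ∈ I, b * x = 0) → b = 0) :
    ∃ h ∈ I, 0 ≤ h ∧ ∀ b, h * b = 0 → b = 0 := by
  obtain ⟨F, hF, hFF, hmax⟩ := exists_maximal_pairwise
    (fun p : A => IsStarProjection p ∧ p ≠ 0 ∧ ∃ x ∈ I, ∀ b, star x * b = 0 → p * b = 0)
    (fun p q => p * q = 0)
  have : Countable F := (hsf.countable (fun p hp => ⟨(hF p hp).1, (hF p hp).2.1⟩) hFF).to_subtype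
  choose x hxI hx using fun p : F => (hF p p.2).2.2
  obtain ⟨h, hhI, hh0, hh⟩ := exists_nonneg_mem_of_countable hI hIc hxI
  refine ⟨h, hhI, hh0, ?_⟩
  obtain ⟨t, ht, hta⟩ := hAW.exists_annihilator {h}
  simp only [Set.mem_singleton_iff, forall_eq] at hta
  have hpt : ∀ p ∈ F, p * t = 0 := fun p hp =>
    hx ⟨p, hp⟩ t (hh t ((hta t).2 ht.isIdempotentElem) ⟨p, hp⟩)
  suffices t = 0 from fun b hb => by rw [← (hta b).1 hb, this, zero_mul]
  refine hann t fun z hz => ?_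
  by_contra htz
  obtain ⟨s, hs, hsa⟩ := hAW.exists_annihilator {h + z * star z}
  simp only [Set.mem_singleton_iff, forall_eq] at hsa
  have hsk := mul_eq_zero_of_add_mul_eq_zero hh0 ((hsa s).2 hs.isIdempotentElem)
  have hts : t * s = s := (hta s).1 hsk.1
  have hst : s * t = s := hs.mul_eq_comm' ht hts
  have hd : IsStarProjection (t - s) := by
    refine ⟨?_, ht.isSelfAdjoint.sub hs.isSelfAdjoint⟩
    rw [IsIdempotentElem, sub_mul, mul_sub, mul_sub, hts, hst, ht.isIdempotentElem.eq,
      hs.isIdempotentElem.eq, sub_self, sub_zero]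
  have hd0 : t - s ≠ 0 := fun h0 => htz (by
    rw [sub_eq_zero] at h0
    rw [h0]
    simpa [star_mul, hs.isSelfAdjoint.star_eq] using congrArg star hsk.2)
  have hpd : ∀ p ∈ F, p * (t - s) = 0 := fun p hp => by
    rw [mul_sub, hpt p hp, ← hts, ← mul_assoc, hpt p hp, zero_mul, sub_self]
  have hdF : t - s ∈ F := by
    refine hmax _ ⟨hd, hd0, ?_⟩ fun p hp =>
      ⟨(hF p hp).1.mul_eq_zero_comm hd (hpd p hp), hpd p hp⟩
    have hsd : IsSelfAdjoint (h + z * star z) :=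
      (IsSelfAdjoint.of_nonneg hh0).add (.mul_star_self z)
    refine ⟨h + z * star z, I.add_mem hhI (hI _ hz _), fun b hb => ?_⟩
    rw [hsd.star_eq] at hb
    rw [← (hsa b).1 hb, ← mul_assoc, sub_mul, hts, hs.isIdempotentElem.eq, sub_self, zero_mul]
  have := hpd _ hdF
  rw [hd.isIdempotentElem.eq] at this
  exact hd0 this

/-- A positive element with zero annihilator is invertible on an orthogonal family of commuting
projections with supremum one. -/
theorem IsAWStar.exists_invertible_pieces (hAW : IsAWStar A) {h : A} (h0 : 0 ≤ h)
    (hh : ∀ b, h * b = 0 → b = 0) :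
    ∃ F : Set A, (∀ e ∈ F, IsStarProjection e ∧ e ≠ 0 ∧ Commute e h ∧ ∃ y, e = h * y) ∧
      F.Pairwise (fun p q => p * q = 0) ∧ ∀ b, (∀ e ∈ F, e * b = 0) → b = 0 := by
  obtain ⟨F, hF, hFF, hmax⟩ := exists_maximal_pairwise
    (fun e : A => IsStarProjection e ∧ e ≠ 0 ∧ Commute e h ∧ ∃ y, e = h * y)
    (fun p q => p * q = 0)
  refine ⟨F, hF, hFF, ?_⟩
  obtain ⟨q, hq⟩ := hAW.exists_isSupport (fun e : F => (e : A))
  set g := 1 - q with hg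
  have hgp : IsStarProjection g := hq.isStarProjection.one_sub
  have heg : ∀ e ∈ F, e * g = 0 := fun e he => by
    rw [hg, mul_sub, hq.mul_eq ⟨e, he⟩, mul_one, sub_self]
  suffices g = 0 from fun b hb => by
    have h1 : q * b = 0 := hq.mul_eq_zero b fun e => hb e e.2
    have h2 : b = g * b + q * b := by rw [hg]; noncomm_ring
    rw [h2, h1, this, zero_mul, add_zero]
  by_contra hg0
  have hqhg : q * (h * g) = 0 := hq.mul_eq_zero _ fun e => by
    rw [← mul_assoc, (hF e e.2).2.2.1.eq, mul_assoc, heg e e.2, mul_zero]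
  have hghg : g * h * g = h * g := by
    have : h * g = g * h * g + q * (h * g) := by rw [hg]; noncomm_ring
    rw [this, hqhg, add_zero]
  have hgh : h * g = g * h := by
    have := congrArg star hghg
    simp only [star_mul, hgp.isSelfAdjoint.star_eq, (IsSelfAdjoint.of_nonneg h0).star_eq] at this
    rw [← mul_assoc, hghg] at this
    exact this
  have hk0 : 0 ≤ h * g := by
    rw [← hghg]
    simpa [hgp.isSelfAdjoint.star_eq] using star_left_conjugate_nonneg h0 g
  obtain ⟨p, y, hp, hp0, -, -, -, hkp, hpk⟩ := hAW.exists_spectral_projection hk0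
    fun h1 => hg0 (hh g h1)
  have hgp' : g * p = p := by
    rw [← hkp, hgh]
    simp only [← mul_assoc, hgp.isIdempotentElem.eq]
  have hpg : p * g = p := hp.mul_eq_comm' hgp hgp'
  have hep : ∀ e ∈ F, e * p = 0 := fun e he => by
    rw [← hgp', ← mul_assoc, heg e he, zero_mul]
  have hpF : p ∈ F := by
    refine hmax p ⟨hp, hp0, ?_, g * (y * y), by rw [← mul_assoc, hkp]⟩ fun e he =>
      ⟨(hF e he).1.mul_eq_zero_comm hp (hep e he), hep e he⟩
    calc p * h = p * (h * g) := by rw [hgh, ← mul_assoc, hpg]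
      _ = h * g * p := hpk
      _ = h * p := by rw [mul_assoc, hgp']
  exact hp0 (by rw [← hp.isIdempotentElem.eq]; exact hep p hpF)

/-- A nonzero projection below a member of `F`. -/
structure IsPiece (F : Set A) (x : A) : Prop where
  isStarProjection : IsStarProjection x
  ne_zero : x ≠ 0
  exists_le : ∃ e ∈ F, e * x = x

theorem IsPiece.of_mul_eq {F : Set A} {x y : A} (hx : IsPiece F x) (hy : IsStarProjection y)
    (hy0 : y ≠ 0) (h : x * y = y) : IsPiece F y := by
  obtain ⟨e, he, hex⟩ := hx.exists_le
  exact ⟨hy, hy0, e, he, by rw [← h, ← mul_assoc, hex]⟩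

theorem IsAWStar.exists_implementing_union (hAW : IsAWStar A) {f : A → A} {S T : Set A}
    (hS : ∀ x ∈ S, IsStarProjection x) (hST : ∀ x ∈ S, ∀ y ∈ T, x * y = 0)
    (hfS : ∃ b, ∀ x ∈ S, b * x = f x) (hfT : ∃ b, ∀ x ∈ T, b * x = f x) :
    ∃ b, ∀ x ∈ S ∪ T, b * x = f x := by
  obtain ⟨b, hb⟩ := hfS
  obtain ⟨c, hc⟩ := hfT
  obtain ⟨q, hq⟩ := hAW.exists_isSupport (fun x : S => (x : A))
  refine ⟨b * q + c * (1 - q), ?_⟩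
  rintro x (hx | hx)
  · have : q * x = x := hq.mul_eq' (fun x => hS x x.2) ⟨x, hx⟩
    rw [add_mul, mul_assoc, mul_assoc, sub_mul, this, one_mul, sub_self, mul_zero, add_zero,
      hb x hx]
  · have : q * x = 0 := hq.mul_eq_zero x fun y => hST y y.2 x hx
    rw [add_mul, mul_assoc, mul_assoc, sub_mul, this, one_mul, mul_zero, zero_add, sub_zero,
      hc x hx]

/-- Three partial isometries with the same initial projection and orthogonal ranges among the
pieces. -/
structure IsTriple (F : Set A) (w : Fin 3 → A) : Prop where
  star_mul_eq : ∀ i j, star (w i) * w i = star (w j) * w j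
  isPiece : ∀ i, IsPiece F (w i * star (w i))
  orthogonal : ∀ i j, i ≠ j → star (w i) * w j = 0

/-- The pieces exhaust the unit by a family of triples and two centrally orthogonal families. -/
theorem IsAWStar.exists_exhausting_pieces (hAW : IsAWStar A) (F : Set A) :
    ∃ (T : Set (Fin 3 → A)) (X Y : Set A), (∀ t ∈ T, IsTriple F t) ∧
      (T.Pairwise fun t s => ∀ i j, star (t i) * s j = 0) ∧
      (∀ x ∈ X ∪ Y, IsPiece F x ∧ ∀ t ∈ T, ∀ i, x * t i = 0) ∧
      (X.Pairwise fun x y => ∀ a, x * a * y = 0) ∧ (Y.Pairwise fun x y => ∀ a, x * a * y = 0) ∧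
      (∀ x ∈ X, ∀ y ∈ Y, x * y = 0) ∧
      ∀ r, IsPiece F r → ¬ ((∀ t ∈ T, ∀ i, r * t i = 0) ∧ ∀ x ∈ X ∪ Y, r * x = 0) := by
  obtain ⟨T, hT, hTT, hTmax⟩ := exists_maximal_pairwise (IsTriple F)
    (fun t s => ∀ i j, star (t i) * s j = 0)
  obtain ⟨X, hX, hXX, hXmax⟩ := exists_maximal_pairwise
    (fun x => IsPiece F x ∧ ∀ t ∈ T, ∀ i, x * t i = 0) (fun x y => ∀ a, x * a * y = 0)
  obtain ⟨Y, hY, hYY, hYmax⟩ := exists_maximal_pairwise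
    (fun x => IsPiece F x ∧ (∀ t ∈ T, ∀ i, x * t i = 0) ∧ ∀ y ∈ X, y * x = 0)
    (fun x y => ∀ a, x * a * y = 0)
  refine ⟨T, X, Y, hT, hTT, ?_, hXX, hYY, fun x hx y hy => (hY y hy).2.2 x hx, ?_⟩
  · rintro x (hx | hx)
    exacts [hX x hx, ⟨(hY x hx).1, (hY x hx).2.1⟩]
  rintro r hr ⟨hrT, hrXY⟩
  have comm0 : ∀ x y : A, IsStarProjection x → IsStarProjection y → (∀ a, x * a * y = 0) →
      (∀ a, x * a * y = 0) ∧ ∀ a, y * a * x = 0 := fun x y hx hy h => ⟨h, fun a => by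
    simpa [star_mul, hx.isSelfAdjoint.star_eq, hy.isSelfAdjoint.star_eq, mul_assoc] using
      congrArg star (h (star a))⟩
  have hrp := hr.isStarProjection
  obtain ⟨y, hy, a, ha⟩ : ∃ y ∈ Y, ∃ a, r * a * y ≠ 0 := by
    by_contra! hcon
    have : r ∈ Y := hYmax r ⟨hr, hrT, fun x hx =>
        hrp.mul_eq_zero_comm (hX x hx).1.isStarProjection (hrXY x (.inl hx))⟩ fun s hs =>
      comm0 _ _ hrp (hY s hs).1.isStarProjection (hcon s hs)
    exact hr.ne_zero (by rw [← hrp.isIdempotentElem.eq]; exact hrXY r (.inr this))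
  have hyp := (hY y hy).1.isStarProjection
  obtain ⟨v, hv0, hv, hrv, hvy⟩ := hAW.exists_partialIsometry hrp hyp ha
  have hx1 := hv.isStarProjection_star_mul
  have hyx1 : y * (star v * v) = star v * v := by rw [← mul_assoc, hyp.star_mul_eq hvy]
  have hx1p : IsPiece F (star v * v) := (hY y hy).1.of_mul_eq hx1
    (by rwa [Ne, CStarRing.star_mul_self_eq_zero_iff]) hyx1
  obtain ⟨x, hx, a', ha'⟩ : ∃ x ∈ X, ∃ a, star v * v * a * x ≠ 0 := by
    by_contra! hcon
    have : star v * v ∈ X := hXmax _ ⟨hx1p, fun t ht i => by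
        rw [← hx1.mul_eq_comm' hyp hyx1, mul_assoc, (hY y hy).2.1 t ht, mul_zero]⟩ fun s hs =>
      comm0 _ _ hx1 (hX s hs).1.isStarProjection (hcon s hs)
    refine hx1p.ne_zero ?_
    rw [← hyx1]
    exact hx1.mul_eq_zero_comm hyp ((hY y hy).2.2 _ this)
  have hxp := (hX x hx).1.isStarProjection
  obtain ⟨v', hv0', hv', hxv', hvx'⟩ := hAW.exists_partialIsometry hx1 hxp ha'
  have hxsv : x * star v' = star v' := hxp.star_mul_eq hvx'
  have hyv' : y * v' = v' := by rw [← hxv', ← mul_assoc, hyx1]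
  have hx2 := hv'.isStarProjection_mul_star
  set p := v' * star v' with hp
  have hp0 : p ≠ 0 := by rwa [Ne, CStarRing.mul_star_self_eq_zero_iff]
  have hx1p' : star v * v * p = p := by rw [hp, ← mul_assoc, hxv']
  have hyp' : y * p = p := by rw [hp, ← mul_assoc, hyv']
  have hpy : p * y = p := hx2.mul_eq_comm' hyp hyp'
  have hps : star p = p := hx2.isSelfAdjoint.star_eq
  have hpp : p * p = p := hx2.isIdempotentElem.eq
  have hxy : x * y = 0 := (hY y hy).2.2 x hx
  have hyr : y * r = 0 := hrp.mul_eq_zero_comm hyp (hrXY y (.inr hy))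
  have hxr : x * r = 0 := hrp.mul_eq_zero_comm hxp (hrXY x (.inl hx))
  have hrvp : r * (v * p) = v * p := by rw [← mul_assoc, hrv]
  have hsvp : star (v * p) * (v * p) = p := by
    rw [star_mul, hps, mul_assoc, ← mul_assoc (star v), hx1p', hpp]
  have hvpI : IsPartialIsometry (v * p) := .of_isIdempotentElem (by rw [hsvp]; exact hpp)
  have o01 : v' * p = 0 := by rw [← hvx', mul_assoc, ← hyp', ← mul_assoc x, hxy]; simp
  have o02 : v' * (v * p) = 0 := by rw [← hvx', mul_assoc, ← hrvp, ← mul_assoc x, hxr]; simp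
  have o12 : p * (v * p) = 0 := by
    rw [← hrvp, ← mul_assoc, ← hpy, mul_assoc p, hyr]; simp
  have hw : IsTriple F ![star v', p, v * p] := by
    refine ⟨?_, ?_, ?_⟩
    · have : ∀ i, star ((![star v', p, v * p] : Fin 3 → A) i) *
          (![star v', p, v * p] : Fin 3 → A) i = p := by
        intro i
        fin_cases i
        exacts [by simp [hp], by simp [hps, hpp], by simpa using hsvp]
      exact fun i j => (this i).trans (this j).symm
    · intro i
      fin_cases i
      · refine (hX x hx).1.of_mul_eq (y := star v' * star (star v')) ?_ ?_ ?_
        · simpa using hv'.isStarProjection_star_mul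
        · simpa using hv0'
        · rw [← mul_assoc, hxsv]
      · show IsPiece F (p * star p)
        rw [hps, hpp]
        exact (hY y hy).1.of_mul_eq hx2 hp0 hyp'
      · refine hr.of_mul_eq (y := v * p * star (v * p)) hvpI.isStarProjection_mul_star ?_ ?_
        · rw [Ne, CStarRing.mul_star_self_eq_zero_iff]
          intro h
          rw [h, mul_zero] at hsvp
          exact hp0 hsvp.symm
        · rw [← mul_assoc, hrvp]
    · have o10 : star p * star v' = 0 := by simpa using congrArg star o01
      have o20 : star (v * p) * star v' = 0 := by simpa using congrArg star o02
      have o21 : star (v * p) * p = 0 := by simpa [hps] using congrArg star o12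
      intro i j hij
      fin_cases i <;> fin_cases j <;> first | exact absurd rfl hij | skip
      exacts [by simpa using o01, by simpa using o02, o10, by simpa [hps] using o12, o20, o21]
  have hcov : ∀ i, ∃ s, IsStarProjection s ∧ s * (![star v', p, v * p] : Fin 3 → A) i =
      (![star v', p, v * p] : Fin 3 → A) i ∧ ∀ t ∈ T, ∀ i, s * t i = 0 := by
    intro i
    fin_cases i
    exacts [⟨x, hxp, hxsv, (hX x hx).2⟩, ⟨y, hyp, hyp', (hY y hy).2.1⟩, ⟨r, hrp, hrvp, hrT⟩]
  have hwT : ![star v', p, v * p] ∈ T := by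
    have key : ∀ t ∈ T, ∀ i j, star ((![star v', p, v * p] : Fin 3 → A) i) * t j = 0 := by
      intro t ht i j
      obtain ⟨s, hs, hsw, hst⟩ := hcov i
      rw [← hsw, star_mul, hs.isSelfAdjoint.star_eq, mul_assoc, hst t ht, mul_zero]
    exact hTmax _ hw fun t ht => ⟨key t ht, fun i j => by
      simpa using congrArg star (key t ht j i)⟩
  have := (hX x hx).2 _ hwT 0
  exact hv0' (star_eq_zero.1 (hxsv.symm.trans this))

/-- A bounded module map is implemented at every positive element with zero annihilator. -/
theorem IsAWStar.exists_implementing_at (hAW : IsAWStar A) (hsf : SigmaFiniteAlg A)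
    {I : Submodule ℂ A} (hI : IsRightIdeal I) (hIc : IsClosed (I : Set A)) {f : A → A}
    (hf : IsBoundedModuleMap I f) {h : A} (hhI : h ∈ I) (h0 : 0 ≤ h)
    (hh : ∀ b, h * b = 0 → b = 0) : ∃ c, c * h = f h := by
  obtain ⟨F, hF, hFF, hF1⟩ := hAW.exists_invertible_pieces h0 hh
  have hFI : ∀ e ∈ F, e ∈ I := fun e he => by
    obtain ⟨y, rfl⟩ := (hF e he).2.2.2
    exact hI _ hhI _
  have hpI : ∀ x, IsPiece F x → x ∈ I := fun x hx => by
    obtain ⟨e, he, hex⟩ := hx.exists_le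
    rw [← hex]
    exact hI _ (hFI e he) _
  obtain ⟨T, X, Y, hT, hTT, hXY, hXX, hYY, hXY0, hmax⟩ := hAW.exists_exhausting_pieces F
  have hpi : ∀ t ∈ T, ∀ i, IsPartialIsometry (t i) := fun t ht i => by
    have : IsPartialIsometry (star (t i)) := .of_isIdempotentElem (by
      rw [star_star]; exact ((hT t ht).isPiece i).isStarProjection.isIdempotentElem)
    refine .of_isIdempotentElem ?_
    simpa using this.isStarProjection_mul_star.isIdempotentElem
  have : Countable T := by
    have hinj : Set.InjOn (fun t : Fin 3 → A => t 0 * star (t 0)) T := by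
      intro t ht s hs hts
      by_contra hne
      refine ((hT t ht).isPiece 0).ne_zero ?_
      calc t 0 * star (t 0) = t 0 * star (t 0) * (t 0 * star (t 0)) :=
            ((hT t ht).isPiece 0).isStarProjection.isIdempotentElem.eq.symm
        _ = t 0 * star (t 0) * (s 0 * star (s 0)) := congrArg (t 0 * star (t 0) * ·) hts
        _ = 0 := by
          rw [mul_assoc, ← mul_assoc (star (t 0)), hTT ht hs hne 0 0]
          simp
    refine Set.Countable.to_subtype (Set.countable_of_injective_of_countable_image hinj
      (hsf.countable ?_ ?_))
    · rintro _ ⟨t, ht, rfl⟩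
      exact ⟨((hT t ht).isPiece 0).isStarProjection, ((hT t ht).isPiece 0).ne_zero⟩
    · rintro _ ⟨t, ht, rfl⟩ _ ⟨s, hs, rfl⟩ hne
      have hts : t ≠ s := by rintro rfl; exact hne rfl
      dsimp only
      rw [mul_assoc, ← mul_assoc (star (t 0)), hTT ht hs hts]
      simp
  let S : Fin 3 → Set A := fun i => Set.image (fun t : Fin 3 → A => t i * star (t i)) T
  have hSp : ∀ i, ∀ x ∈ S i, IsPiece F x := by
    rintro i _ ⟨t, ht, rfl⟩
    exact (hT t ht).isPiece i
  have hSS : ∀ i j, i ≠ j → ∀ x ∈ S i, ∀ y ∈ S j, x * y = 0 := by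
    rintro i j hij _ ⟨t, ht, rfl⟩ _ ⟨s, hs, rfl⟩
    dsimp only
    rw [mul_assoc, ← mul_assoc (star (t i))]
    rcases eq_or_ne t s with rfl | hts
    · rw [(hT t ht).orthogonal i j hij]; simp
    · rw [hTT ht hs hts]; simp
  have hfS : ∀ i j k : Fin 3, i ≠ j → i ≠ k → j ≠ k → ∃ b, ∀ x ∈ S i, b * x = f x := by
    intro i j k hij hik hjk
    have hwk : ∀ t : T, ∀ l, star (t.1 l * star (t.1 i)) * (t.1 l * star (t.1 i)) =
        t.1 i * star (t.1 i) := fun t l => by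
      rw [star_mul, star_star, mul_assoc, ← mul_assoc (star (t.1 l)), (hT _ t.2).star_mul_eq l i,
        ← mul_assoc, show t.1 i * (star (t.1 i) * t.1 i) = t.1 i from hpi _ t.2 i]
    have horth : ∀ (t s : T) (l m : Fin 3), (t ≠ s ∨ l ≠ m) → star (t.1 l) * s.1 m = 0 := by
      rintro t s l m hlm
      rcases eq_or_ne t s with rfl | hts
      · exact (hT _ t.2).orthogonal l m (by simpa using hlm)
      · exact hTT t.2 s.2 (fun h => hts (Subtype.ext h)) l m
    have hwo : ∀ (t s : T) (l m : Fin 3), (t ≠ s ∨ l ≠ m) →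
        star (t.1 l * star (t.1 i)) * (s.1 m * star (s.1 i)) = 0 := fun t s l m hlm => by
      rw [star_mul, mul_assoc, ← mul_assoc (star (t.1 l)), horth t s l m hlm]; simp
    have hxo : ∀ (t s : T) (l m : Fin 3), (t ≠ s ∨ l ≠ m) →
        t.1 l * star (t.1 l) * (s.1 m * star (s.1 i)) = 0 := fun t s l m hlm => by
      rw [mul_assoc, ← mul_assoc (star (t.1 l)), horth t s l m hlm]; simp
    obtain ⟨b, hb⟩ := hAW.exists_implementing_of_copies hI hIc hf
      (x := fun t : T => t.1 i * star (t.1 i)) (u := fun t : T => t.1 j * star (t.1 i))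
      (v := fun t : T => t.1 k * star (t.1 i))
      (fun t => ((hT _ t.2).isPiece i).isStarProjection)
      (fun t s hts => hxo t s i i (.inl hts))
      (fun t => hpI _ ((hT _ t.2).isPiece i)) (fun t => hwk t j) (fun t => hwk t k)
      (fun t s hts => hwo t s j j (.inl hts)) (fun t s hts => hwo t s k k (.inl hts))
      (fun t s => hxo s t i j (.inr hij)) (fun t s => hxo s t i k (.inr hik))
      (fun t s => hwo s t k j (.inr hjk.symm))
    refine ⟨b, ?_⟩
    rintro _ ⟨t, ht, rfl⟩
    exact hb ⟨t, ht⟩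
  have hfC : ∀ Z : Set A, (∀ x ∈ Z, IsPiece F x) →
      (Z.Pairwise fun x y => ∀ a, x * a * y = 0) → ∃ b, ∀ x ∈ Z, b * x = f x := by
    intro Z hZ hZZ
    have hca : ∀ x y : Z, x ≠ y → ∀ a, x.1 * a * y.1 = 0 := fun x y hxy =>
      hZZ x.2 y.2 fun h => hxy (Subtype.ext h)
    obtain ⟨b, hb⟩ := hAW.exists_implementing_of_centrally_orthogonal hf (x := fun x : Z => x.1)
      (fun x => (hZ x x.2).isStarProjection) (fun x => hpI _ (hZ x x.2))
      (fun x y hxy => by simpa using hca x y hxy 1) hca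
    exact ⟨b, fun x hx => hb ⟨x, hx⟩⟩
  have hSXY : ∀ i, ∀ x ∈ X ∪ Y, ∀ y ∈ S i, x * y = 0 := by
    rintro i x hx _ ⟨t, ht, rfl⟩
    dsimp only
    rw [← mul_assoc, (hXY x hx).2 t ht, zero_mul]
  have hU : ∃ b, ∀ x ∈ (X ∪ Y) ∪ (S 0 ∪ (S 1 ∪ S 2)), b * x = f x := by
    refine hAW.exists_implementing_union (fun x hx => (hXY x hx).1.isStarProjection) ?_
      (hAW.exists_implementing_union (fun x hx => (hXY x (.inl hx)).1.isStarProjection) hXY0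
        (hfC X (fun x hx => (hXY x (.inl hx)).1) hXX) (hfC Y (fun x hx => (hXY x (.inr hx)).1) hYY))
      (hAW.exists_implementing_union (fun x hx => (hSp 0 x hx).isStarProjection) ?_
        (hfS 0 1 2 (by decide) (by decide) (by decide))
        (hAW.exists_implementing_union (fun x hx => (hSp 1 x hx).isStarProjection)
          (hSS 1 2 (by decide)) (hfS 1 0 2 (by decide) (by decide) (by decide))
          (hfS 2 0 1 (by decide) (by decide) (by decide))))
    · rintro x hx y (hy | hy | hy)
      exacts [hSXY 0 x hx y hy, hSXY 1 x hx y hy, hSXY 2 x hx y hy]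
    · rintro x hx y (hy | hy)
      exacts [hSS 0 1 (by decide) x hx y hy, hSS 0 2 (by decide) x hx y hy]
  obtain ⟨c, hc⟩ := hU
  set U := (X ∪ Y) ∪ (S 0 ∪ (S 1 ∪ S 2)) with hUdef
  have hUp : ∀ x ∈ U, IsPiece F x := by
    rintro x (hx | hx | hx | hx)
    exacts [(hXY x hx).1, hSp 0 x hx, hSp 1 x hx, hSp 2 x hx]
  have hUmax : ∀ r, IsPiece F r → ¬ ∀ x ∈ U, x * r = 0 := by
    intro r hr hUr
    have hrU : ∀ x ∈ U, r * x = 0 := fun x hx =>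
      (hUp x hx).isStarProjection.mul_eq_zero_comm hr.isStarProjection (hUr x hx)
    refine hmax r hr ⟨fun t ht i => ?_, fun x hx => hrU x (.inl hx)⟩
    have hm : t i * star (t i) ∈ U := by
      have : t i * star (t i) ∈ S i := ⟨t, ht, rfl⟩
      fin_cases i
      exacts [.inr (.inl this), .inr (.inr (.inl this)), .inr (.inr (.inr this))]
    have := hrU _ hm
    rw [← show t i * (star (t i) * t i) = t i from hpi t ht i, ← mul_assoc (t i), ← mul_assoc,
      this, zero_mul]
  -- every piece is compatible with the members of `F`
  have heU : ∀ e ∈ F, ∀ x ∈ U, e * x = x ∨ e * x = 0 := fun e he x hx => by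
    obtain ⟨e', he', hex⟩ := (hUp x hx).exists_le
    rcases eq_or_ne e e' with rfl | hne
    · exact .inl hex
    · right
      rw [← hex, ← mul_assoc, hFF he he' hne, zero_mul]
  obtain ⟨q, hq⟩ := hAW.exists_isSupport (fun x : U => (x : A))
  have hq1 : 1 - q = 0 := by
    have hR : IsStarProjection (1 - q) := hq.isStarProjection.one_sub
    have hxR : ∀ x ∈ U, x * (1 - q) = 0 := fun x hx => by
      rw [mul_sub, hq.mul_eq ⟨x, hx⟩, mul_one, sub_self]
    refine hF1 _ fun e he => ?_
    by_contra hne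
    have hep := (hF e he).1
    have hxeR : ∀ x ∈ U, x * (e * (1 - q)) = 0 := fun x hx => by
      have hxp := (hUp x hx).isStarProjection
      rw [← mul_assoc]
      rcases heU e he x hx with h1 | h1
      · rw [hxp.mul_eq_comm' hep h1, hxR x hx]
      · rw [hep.mul_eq_zero_comm hxp h1, zero_mul]
    have hqe : q * (e * (1 - q)) = 0 := hq.mul_eq_zero _ fun x => hxeR x x.2
    have h1 : e * (1 - q) = (1 - q) * e * (1 - q) := by
      have : e * (1 - q) = (1 - q) * e * (1 - q) + q * (e * (1 - q)) := by noncomm_ring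
      rw [hqe, add_zero] at this
      exact this
    have hsa : IsSelfAdjoint (e * (1 - q)) := by
      rw [h1, isSelfAdjoint_iff]
      simp only [star_mul, hep.isSelfAdjoint.star_eq, hR.isSelfAdjoint.star_eq, mul_assoc]
    have hid : IsIdempotentElem (e * (1 - q)) := by
      rw [IsIdempotentElem]
      calc e * (1 - q) * (e * (1 - q)) = e * ((1 - q) * e * (1 - q)) := by
            simp only [mul_assoc]
        _ = e * (1 - q) := by rw [← h1, ← mul_assoc, hep.isIdempotentElem.eq]
    exact hUmax _ ⟨⟨hid, hsa⟩, hne, e, he, by rw [← mul_assoc, hep.isIdempotentElem.eq]⟩ hxeR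
  have hce : ∀ e ∈ F, c * e = f e := fun e he => by
    have : (c * e - f e) * q = 0 := by
      refine hq.mul_support_eq_zero (fun x => (hUp x x.2).isStarProjection) fun x => ?_
      rw [sub_mul, mul_assoc, ← hf.map_mul e (hFI e he)]
      rcases heU e he x x.2 with h1 | h1
      · rw [h1, hc x x.2, sub_self]
      · rw [h1, hf.map_zero, mul_zero, sub_self]
    rw [← sub_eq_zero]
    have h2 : c * e - f e = (c * e - f e) * (1 - q) + (c * e - f e) * q := by noncomm_ring
    rw [h2, this, hq1, mul_zero, add_zero]
  refine ⟨c, ?_⟩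
  rw [← sub_eq_zero, ← star_eq_zero]
  refine hF1 _ fun e he => ?_
  have : (c * h - f h) * e = 0 := by
    rw [sub_mul, mul_assoc, ← hf.map_mul h hhI, ← (hF e he).2.2.1.eq,
      hf.map_mul e (hFI e he), ← hce e he, mul_assoc, sub_self]
  simpa [star_mul, (hF e he).1.isSelfAdjoint.star_eq] using congrArg star this

theorem stmt9 (hAW : IsAWStar A) (hsf : SigmaFiniteAlg A)
    (I : Submodule ℂ A) (hIr : IsRightIdeal I) (hIc : IsClosed (I : Set A))
    (hann : ∀ b : A, (∀ x ∈ I, b * x = 0) → b = 0)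
    (f : A → A)
    (hadd : ∀ x ∈ I, ∀ y ∈ I, f (x + y) = f x + f y)
    (hsmul : ∀ c : ℂ, ∀ x ∈ I, f (c • x) = c • f x)
    (hmod : ∀ x ∈ I, ∀ r : A, f (x * r) = f x * r)
    (hbdd : ∃ C : ℝ, ∀ x ∈ I, ‖f x‖ ≤ C * ‖x‖) :
    ∃! c : A, ∀ x ∈ I, f x = c * x := by
  have hf : IsBoundedModuleMap I f := ⟨hadd, hmod, by
    obtain ⟨C, hC⟩ := hbdd
    exact ⟨max C 0, le_max_right _ _, fun x hx => (hC x hx).trans (by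
      gcongr; exact le_max_left _ _)⟩⟩
  obtain ⟨h, hhI, h0, hh⟩ := hAW.exists_nonneg_mem_of_annihilator_eq_zero hsf hIr hIc hann
  have hhs : star h = h := (IsSelfAdjoint.of_nonneg h0).star_eq
  have key : ∀ x ∈ I, ∃ c, c * h = f h ∧ c * x = f x := fun x hx => by
    have hxx0 : 0 ≤ x * star x := mul_star_self_nonneg x
    have hhh0 : 0 ≤ h * star h := mul_star_self_nonneg h
    have hkI : h * star h + x * star x ∈ I := I.add_mem (hIr _ hhI _) (hIr _ hx _)
    obtain ⟨c, hc⟩ := hAW.exists_implementing_at hsf hIr hIc hf hkI (add_nonneg hhh0 hxx0)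
      fun b hb => hh b (by simpa [hhs] using hh _ (by
        simpa [hhs, mul_assoc] using (mul_eq_zero_of_add_mul_eq_zero hhh0 hb).1))
    have hd := (IsBoundedModuleMap.const_mul I c).sub hf
    have hd0 : c * (h * star h + x * star x) - f (h * star h + x * star x) = 0 := by
      rw [hc, sub_self]
    exact ⟨c, sub_eq_zero.1 (hd.eq_zero_of_mul_star_le hIr (add_nonneg hhh0 hxx0) hkI hd0 hhI
        (le_add_of_nonneg_right hxx0)),
      sub_eq_zero.1 (hd.eq_zero_of_mul_star_le hIr (add_nonneg hhh0 hxx0) hkI hd0 hx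
        (le_add_of_nonneg_left hhh0))⟩
  obtain ⟨c, hch, -⟩ := key h hhI
  refine ⟨c, fun x hx => ?_, fun c' hc' => ?_⟩
  · obtain ⟨d, hdh, hdx⟩ := key x hx
    have : h * star (d - c) = 0 := by
      have h1 : (d - c) * h = 0 := by rw [sub_mul, hdh, hch, sub_self]
      simpa [star_mul, hhs] using congrArg star h1
    have := hh _ this
    rw [star_eq_zero, sub_eq_zero] at this
    rw [← hdx, this]
  · have h1 : (c' - c) * h = 0 := by rw [sub_mul, ← hc' h hhI, hch, sub_self]
    have := hh (star (c' - c)) (by simpa [star_mul, hhs] using congrArg star h1)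
    rwa [star_eq_zero, sub_eq_zero] at this
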